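/- Let k ≥ 2 be an integer, let 0 ≤ ε < 1/2, and let F be a finite family of subsets of {1,…,n} with F ≠ {∅} and F nonempty, such that F is (1-ε)-approximate k-union closed: for at least a (1-ε)-fraction of the k-tuples (A₁,…,A_k) ∈ F^k, the union A₁ ∪ ⋯ ∪ A_k belongs to F. Then there exists an element i ∈ {1,…,n} contained in at least an (α_k/(1+α_k) − δ)-fraction of the sets in F, where δ = (kε + 2ε·log(1/ε)/log|F|)^{1/(k-1)} and α_k is the unique positive solution to x(1+x)^{k-1} = 1. -/

import Mathlib

open Real in
theorem concaveOn_logMean_one :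
    ConcaveOn ℝ (Set.Ioo (0 : ℝ) 1) fun y => (y - 1) / log y := by
  have hint : ∀ y ∈ Set.Ioo (0 : ℝ) 1, (y - 1) / log y = ∫ s in (0 : ℝ)..1, y ^ s := by
    intro y hy
    have hlog : log y ≠ 0 := (log_neg hy.1 hy.2).ne
    have hd : ∀ s ∈ Set.uIcc (0 : ℝ) 1, HasDerivAt (fun s => y ^ s / log y) (y ^ s) s := by
      intro s _
      have := (hasStrictDerivAt_const_rpow hy.1 s).hasDerivAt.div_const (log y)
      rwa [mul_div_assoc, div_self hlog, mul_one] at this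
    rw [intervalIntegral.integral_eq_sub_of_hasDerivAt hd
      ((continuous_const_rpow hy.1.ne').intervalIntegrable _ _)]
    simp [sub_div]
  refine ⟨convex_Ioo 0 1, fun x hx y hy a b ha hb hab => ?_⟩
  have hxy := convex_Ioo (0 : ℝ) 1 hx hy ha hb hab
  have hci : ∀ z ∈ Set.Ioo (0 : ℝ) 1,
      IntervalIntegrable (fun s : ℝ => z ^ s) MeasureTheory.volume 0 1 :=
    fun z hz => (continuous_const_rpow hz.1.ne').intervalIntegrable _ _
  simp only [smul_eq_mul] at hxy ⊢
  rw [hint x hx, hint y hy, hint _ hxy]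
  rw [← intervalIntegral.integral_const_mul, ← intervalIntegral.integral_const_mul,
    ← intervalIntegral.integral_add ((hci x hx).const_mul a) ((hci y hy).const_mul b)]
  refine intervalIntegral.integral_mono_on zero_le_one
    (((hci x hx).const_mul a).add ((hci y hy).const_mul b)) (hci _ hxy) fun s hs => ?_
  exact (concaveOn_rpow hs.1 hs.2).2 hx.1.le hy.1.le ha hb hab

/-- The reciprocal of `log x * log (1 - x) / binEntropy x`, the elasticity of
`t ↦ exp t * binEntropy (exp (-t))`. -/
noncomputable def symmLogMean (x : ℝ) : ℝ :=
  (x - 1) / Real.log x + (1 - x - 1) / Real.log (1 - x)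

theorem symmLogMean_one_sub (x : ℝ) : symmLogMean (1 - x) = symmLogMean x := by
  simp only [symmLogMean, sub_sub_cancel]
  ring

theorem symmLogMean_le {x z : ℝ} (hx : 0 < x) (hxz : x ≤ z) (hz : z ≤ 1 - x) :
    symmLogMean x ≤ symmLogMean z := by
  obtain ⟨a, b, ha, hb, hab, rfl⟩ : z ∈ segment ℝ x (1 - x) := by
    rw [segment_eq_Icc (hxz.trans hz)]; exact ⟨hxz, hz⟩
  have hx0 : x ∈ Set.Ioo (0 : ℝ) 1 := ⟨hx, by linarith⟩
  have hx1 : 1 - x ∈ Set.Ioo (0 : ℝ) 1 := ⟨by linarith, by linarith⟩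
  have h1 := concaveOn_logMean_one.2 hx0 hx1 ha hb hab
  have h2 := concaveOn_logMean_one.2 hx1 hx0 ha hb hab
  have e : a • (1 - x) + b • x = 1 - (a • x + b • (1 - x)) := by
    simp only [smul_eq_mul]; linear_combination hab
  rw [e] at h2
  have hs : symmLogMean x = a * symmLogMean x + b * symmLogMean x := by
    rw [← add_mul, hab, one_mul]
  rw [hs]
  simp only [symmLogMean, smul_eq_mul] at h1 h2 ⊢
  linarith

open Real in
theorem binEntropy_eq_mul_symmLogMean {x : ℝ} (hx : x ∈ Set.Ioo (0 : ℝ) 1) :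
    binEntropy x = log x * log (1 - x) * symmLogMean x := by
  have h1 := (log_neg hx.1 hx.2).ne
  have h2 := (log_neg (sub_pos.2 hx.2) (by linarith [hx.1])).ne
  rw [binEntropy, symmLogMean, log_inv, log_inv]
  field_simp
  ring

open Real in
theorem hasDerivAt_binEntropy_div_self {x : ℝ} (hx : x ∈ Set.Ioo (0 : ℝ) 1) :
    HasDerivAt (fun x => binEntropy x / x) (log (1 - x) / x ^ 2) x := by
  have h := (hasDerivAt_binEntropy hx.1.ne' hx.2.ne).div (hasDerivAt_id x) hx.1.ne'
  refine HasDerivAt.congr_deriv (f := fun x => binEntropy x / x) h ?_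
  simp only [id, binEntropy, log_inv]
  ring

open Real in
theorem hasDerivAt_binEntropy_pow_ratio {k : ℕ} (hk : 1 ≤ k) {x : ℝ}
    (hx : x ∈ Set.Ioo (0 : ℝ) 1) :
    HasDerivAt (fun x => binEntropy (x ^ k) / x ^ k / (binEntropy x / x))
      (-(k * log x * log (1 - x) * log (1 - x ^ k)) / (x ^ k * binEntropy x ^ 2) *
        (symmLogMean (x ^ k) - symmLogMean x)) x := by
  have hxk : x ^ k ∈ Set.Ioo (0 : ℝ) 1 :=
    ⟨pow_pos hx.1 k, pow_lt_one₀ hx.1.le hx.2 (by omega)⟩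
  have hx0 := hx.1.ne'
  have hb := (binEntropy_pos hx.1 hx.2).ne'
  have hp : HasDerivAt (fun x => x ^ k) _ x := hasDerivAt_pow k x
  have h := (HasDerivAt.comp (h := fun x => x ^ k) x (hasDerivAt_binEntropy_div_self hxk) hp).div
    (hasDerivAt_binEntropy_div_self hx) (div_ne_zero hb hx0)
  refine HasDerivAt.congr_deriv
    (f := fun x => binEntropy (x ^ k) / x ^ k / (binEntropy x / x)) h ?_
  have e1 := binEntropy_eq_mul_symmLogMean hx
  have e2 := binEntropy_eq_mul_symmLogMean hxk
  rw [log_pow] at e2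
  obtain ⟨m, rfl⟩ : ∃ m, k = m + 1 := ⟨k - 1, by omega⟩
  simp only [Function.comp, add_tsub_cancel_right]
  field_simp
  rw [e2]
  rw [e1]
  ring

open Real in
/-- Boppana's entropy inequality with a general exponent. -/
theorem pow_mul_binEntropy_le {k : ℕ} (hk : 1 ≤ k) {φ x : ℝ} (hφ : φ ∈ Set.Ioo (0 : ℝ) 1)
    (hφk : φ + φ ^ k = 1) (hx : x ∈ Set.Ioo (0 : ℝ) 1) :
    binEntropy x / x ≤ φ ^ (k - 1) * (binEntropy (x ^ k) / x ^ k) := by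
  set Q : ℝ → ℝ := fun x => binEntropy (x ^ k) / x ^ k / (binEntropy x / x) with hQ
  have hd : ∀ y ∈ Set.Ioo (0 : ℝ) 1, HasDerivAt Q _ y :=
    fun y hy => hasDerivAt_binEntropy_pow_ratio hk hy
  have hpow : ∀ y ∈ Set.Ioo (0 : ℝ) 1, y ^ k ∈ Set.Ioo (0 : ℝ) 1 := fun y hy =>
    ⟨pow_pos hy.1 k, pow_lt_one₀ hy.1.le hy.2 (by omega)⟩
  have hcoef : ∀ y ∈ Set.Ioo (0 : ℝ) 1,
      0 ≤ -(k * log y * log (1 - y) * log (1 - y ^ k)) / (y ^ k * binEntropy y ^ 2) := by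
    intro y hy
    have h1 := log_neg hy.1 hy.2
    have h2 := log_neg (sub_pos.2 hy.2) (by linarith [hy.1])
    have h3 := log_neg (sub_pos.2 (hpow y hy).2) (by linarith [(hpow y hy).1])
    have := (hpow y hy).1
    have h4 : 0 ≤ (k : ℝ) * (log y * log (1 - y)) * -log (1 - y ^ k) :=
      mul_nonneg (mul_nonneg k.cast_nonneg (mul_pos_of_neg_of_neg h1 h2).le) (by linarith)
    apply div_nonneg _ (by positivity)
    linarith
  have hQφ : Q φ ≤ Q x := by
    rcases le_total φ x with h | h
    · have hmono : MonotoneOn Q (Set.Ico φ 1) := by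
        have hsub : ∀ y ∈ Set.Ico φ 1, y ∈ Set.Ioo (0 : ℝ) 1 := fun y hy =>
          ⟨hφ.1.trans_le hy.1, hy.2⟩
        refine monotoneOn_of_deriv_nonneg (convex_Ico _ _)
          (fun y hy => (hd y (hsub y hy)).continuousAt.continuousWithinAt)
          (fun y hy => (hd y (hsub y (interior_subset hy))).differentiableAt.differentiableWithinAt)
          fun y hy => ?_
        have hy' := interior_subset hy
        have hy0 := hsub y hy'
        rw [(hd y hy0).deriv]
        refine mul_nonneg (hcoef y hy0) (sub_nonneg.2 ?_)
        rw [← symmLogMean_one_sub]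
        refine symmLogMean_le (sub_pos.2 hy0.2) ?_ ?_
        · linarith [pow_le_pow_left₀ hφ.1.le hy'.1 k, hy'.1]
        · simpa using pow_le_of_le_one hy0.1.le hy0.2.le (by omega : k ≠ 0)
      exact hmono ⟨le_rfl, hφ.2⟩ ⟨h, hx.2⟩ h
    · have hanti : AntitoneOn Q (Set.Ioc 0 φ) := by
        have hsub : ∀ y ∈ Set.Ioc 0 φ, y ∈ Set.Ioo (0 : ℝ) 1 := fun y hy =>
          ⟨hy.1, hy.2.trans_lt hφ.2⟩
        refine antitoneOn_of_deriv_nonpos (convex_Ioc _ _)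
          (fun y hy => (hd y (hsub y hy)).continuousAt.continuousWithinAt)
          (fun y hy => (hd y (hsub y (interior_subset hy))).differentiableAt.differentiableWithinAt)
          fun y hy => ?_
        have hy' := interior_subset hy
        have hy0 := hsub y hy'
        rw [(hd y hy0).deriv]
        refine mul_nonpos_of_nonneg_of_nonpos (hcoef y hy0) (sub_nonpos.2 ?_)
        refine symmLogMean_le (hpow y hy0).1
          (pow_le_of_le_one hy0.1.le hy0.2.le (by omega : k ≠ 0)) ?_
        linarith [pow_le_pow_left₀ hy0.1.le hy'.2 k, hy'.2]
      exact hanti ⟨hx.1, h⟩ ⟨hφ.1, le_rfl⟩ h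
  have hφpos := binEntropy_pos hφ.1 hφ.2
  have hQφ' : φ ^ (k - 1) * Q φ = 1 := by
    have e : φ ^ k = φ ^ (k - 1) * φ := by rw [← pow_succ]; congr 1; omega
    have e' : binEntropy (φ ^ k) = binEntropy φ := by
      rw [← binEntropy_one_sub]; congr 1; linarith
    have := pow_pos hφ.1 (k - 1)
    have := hφ.1
    simp only [hQ, e']
    rw [e]
    field_simp
  have hgx : 0 < binEntropy x / x := div_pos (binEntropy_pos hx.1 hx.2) hx.1
  have hle : 1 ≤ φ ^ (k - 1) * Q x :=
    hQφ'.symm.le.trans (mul_le_mul_of_nonneg_left hQφ (pow_nonneg hφ.1.le _))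
  have hQx : Q x * (binEntropy x / x) = binEntropy (x ^ k) / x ^ k :=
    div_mul_cancel₀ _ hgx.ne'
  calc binEntropy x / x = 1 * (binEntropy x / x) := (one_mul _).symm
    _ ≤ φ ^ (k - 1) * Q x * (binEntropy x / x) := by gcongr
    _ = _ := by rw [mul_assoc, hQx]

open Real in
theorem div_mul_log_one_sub_le {x y : ℝ} (hx : 0 < x) (hxy : x ≤ y) (hy : y < 1) :
    x / y * log (1 - y) ≤ log (1 - x) := by
  have hy0 := hx.trans_le hxy
  have h := strictConcaveOn_log_Ioi.concaveOn.2 (x := 1 - y) (y := 1) (sub_pos.2 hy)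
    (Set.mem_Ioi.2 one_pos) (div_pos hx hy0).le (sub_nonneg.2 ((div_le_one hy0).2 hxy))
    (by ring)
  have e : (x / y) • (1 - y) + (1 - x / y) • (1 : ℝ) = 1 - x := by
    simp only [smul_eq_mul]; field_simp; ring
  rw [e] at h
  simpa using h

open Real in
theorem concaveOn_exp_mul_binEntropy :
    ConcaveOn ℝ (Set.Ici (0 : ℝ)) fun t => exp t * binEntropy (exp (-t)) := by
  have hd : ∀ t ∈ interior (Set.Ici (0 : ℝ)),
      HasDerivAt (fun t => exp t * binEntropy (exp (-t))) (-log (1 - exp (-t)) * exp t) t := by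
    intro t ht
    rw [interior_Ici] at ht
    have h1 : exp (-t) < 1 := exp_lt_one_iff.2 (neg_lt_zero.2 ht)
    have h := (hasDerivAt_exp t).mul ((hasDerivAt_binEntropy (exp_pos (-t)).ne' h1.ne).comp t
      ((hasDerivAt_exp (-t)).comp t (hasDerivAt_neg t)))
    refine HasDerivAt.congr_deriv (f := fun t => exp t * binEntropy (exp (-t))) h ?_
    simp only [Function.comp, binEntropy, log_inv, log_exp]
    have e : exp t * exp (-t) = 1 := by rw [← exp_add]; simp
    linear_combination (t + log (1 - exp (-t)) - log (1 - exp (-t)) - t) * e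
  refine AntitoneOn.concaveOn_of_deriv (convex_Ici 0) (by fun_prop)
    (fun t ht => (hd t ht).differentiableAt.differentiableWithinAt) fun s hs t ht hst => ?_
  rw [(hd s hs).deriv, (hd t ht).deriv]
  rw [interior_Ici] at hs ht
  have h := div_mul_log_one_sub_le (exp_pos (-t)) (exp_le_exp.2 (neg_le_neg hst))
    (exp_lt_one_iff.2 (neg_lt_zero.2 hs))
  have e : exp (-t) / exp (-s) = exp s * exp (-t) := by rw [exp_neg s]; field_simp
  have e' : exp (-t) * exp t = 1 := by rw [← exp_add]; simp
  rw [e] at h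
  have := mul_le_mul_of_nonneg_right h (exp_pos t).le
  linear_combination this - (exp s * log (1 - exp (-s))) * e'

open Real in
theorem sum_binEntropy_mul_prod_erase_le {ι : Type*} [Fintype ι] [DecidableEq ι] [Nonempty ι]
    {φ : ℝ} (hφ : φ ∈ Set.Ioo (0 : ℝ) 1) (hφk : φ + φ ^ Fintype.card ι = 1)
    {x : ι → ℝ} (hx : ∀ i, x i ∈ Set.Icc (0 : ℝ) 1) :
    ∑ j, binEntropy (x j) * ∏ i ∈ Finset.univ.erase j, x i ≤
      Fintype.card ι * (φ ^ (Fintype.card ι - 1) * binEntropy (∏ i, x i)) := by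
  set k := Fintype.card ι with hk
  have hk0 : 0 < k := Fintype.card_pos
  have hk0' : (0 : ℝ) < k := Nat.cast_pos.2 hk0
  have hP0 : 0 ≤ ∏ i, x i := Finset.prod_nonneg fun i _ => (hx i).1
  have hP1 : ∏ i, x i ≤ 1 := Finset.prod_le_one (fun i _ => (hx i).1) fun i _ => (hx i).2
  by_cases h0 : ∃ i, x i = 0
  · obtain ⟨i, hi⟩ := h0
    have hz : ∑ j, binEntropy (x j) * ∏ i ∈ Finset.univ.erase j, x i = 0 := by
      refine Finset.sum_eq_zero fun j _ => ?_
      by_cases hij : i = j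
      · rw [← hij, hi]; simp
      · rw [Finset.prod_eq_zero (Finset.mem_erase.2 ⟨hij, Finset.mem_univ i⟩) hi, mul_zero]
    rw [hz]
    have := binEntropy_nonneg hP0 hP1
    have := hφ.1
    positivity
  push Not at h0
  have hpos : ∀ i, 0 < x i := fun i => (hx i).1.lt_of_ne' (h0 i)
  have hP : 0 < ∏ i, x i := Finset.prod_pos fun i _ => hpos i
  set G : ℝ → ℝ := fun t => exp t * binEntropy (exp (-t)) with hG
  set τ : ℝ := ∑ i, (k : ℝ)⁻¹ * -log (x i) with hτ
  have hlog : ∀ i, 0 ≤ -log (x i) := fun i => neg_nonneg.2 (log_nonpos (hx i).1 (hx i).2)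
  have hτ0 : 0 ≤ τ := Finset.sum_nonneg fun i _ => mul_nonneg (inv_nonneg.2 hk0'.le) (hlog i)
  have hGx : ∀ y : ℝ, 0 < y → G (-log y) = binEntropy y / y := by
    intro y hy
    simp only [hG, exp_neg, exp_log hy]
    field_simp
  have hJ : ∑ i, (k : ℝ)⁻¹ * G (-log (x i)) ≤ G τ := by
    have := concaveOn_exp_mul_binEntropy.le_map_sum (t := Finset.univ)
      (w := fun _ : ι => (k : ℝ)⁻¹) (p := fun i => -log (x i))
      (fun _ _ => inv_nonneg.2 hk0'.le)
      (by rw [Finset.sum_const, Finset.card_univ, ← hk, nsmul_eq_mul, mul_inv_cancel₀ hk0'.ne'])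
      (fun i _ => hlog i)
    simpa only [smul_eq_mul] using this
  have hkτ : exp (-τ) ^ k = ∏ i, x i := by
    rw [← exp_nat_mul, hτ, ← Finset.mul_sum, Finset.sum_neg_distrib, mul_neg (k : ℝ)⁻¹, neg_neg,
      ← mul_assoc, mul_inv_cancel₀ hk0'.ne', one_mul,
      exp_sum]
    exact Finset.prod_congr rfl fun i _ => exp_log (hpos i)
  have hB : G τ ≤ φ ^ (k - 1) * (binEntropy (∏ i, x i) / ∏ i, x i) := by
    rcases hτ0.eq_or_lt with h | h
    · have : G τ = 0 := by simp [hG, ← h]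
      rw [this]
      have := binEntropy_nonneg hP0 hP1
      have := hφ.1
      positivity
    · have hx' : exp (-τ) ∈ Set.Ioo (0 : ℝ) 1 := ⟨exp_pos _, exp_lt_one_iff.2 (neg_lt_zero.2 h)⟩
      have := pow_mul_binEntropy_le hk0 hφ hφk hx'
      rw [hkτ] at this
      rwa [← hGx _ hx'.1, log_exp, neg_neg] at this
  have hsum : ∑ j, binEntropy (x j) * ∏ i ∈ Finset.univ.erase j, x i =
      (∏ i, x i) * ∑ j, G (-log (x j)) := by
    rw [Finset.mul_sum]
    refine Finset.sum_congr rfl fun j _ => ?_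
    rw [hGx _ (hpos j), ← Finset.mul_prod_erase _ _ (Finset.mem_univ j)]
    have := hpos j
    field_simp
  rw [hsum]
  rw [← Finset.mul_sum, inv_mul_le_iff₀ hk0'] at hJ
  calc (∏ i, x i) * ∑ j, G (-log (x j))
      ≤ (∏ i, x i) * (k * (φ ^ (k - 1) * (binEntropy (∏ i, x i) / ∏ i, x i))) := by 
        gcongr
        exact hJ.trans (by gcongr)
    _ = _ := by field_simp

/-- The entropy contributed by splitting a mass `p + q` into `p` and `q`. -/
noncomputable def splitEntropy (p q : ℝ) : ℝ :=
  Real.negMulLog p + Real.negMulLog q - Real.negMulLog (p + q)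

open Real in
theorem splitEntropy_mul {a p q : ℝ} :
    splitEntropy (a * p) (a * q) = a * splitEntropy p q := by
  simp only [splitEntropy, ← mul_add, negMulLog_mul]
  ring

open Real in
theorem splitEntropy_eq {p q : ℝ} (h : p + q ≠ 0) :
    splitEntropy p q = (p + q) * binEntropy (p / (p + q)) := by
  rw [binEntropy_eq_negMulLog_add_negMulLog_one_sub]
  have e : 1 - p / (p + q) = q / (p + q) := by field_simp; ring
  have hp : p = (p + q) * (p / (p + q)) := by field_simp
  have hq : q = (p + q) * (q / (p + q)) := by field_simp
  rw [e]
  have h1 := @splitEntropy_mul (p + q) (p / (p + q)) (q / (p + q))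
  rw [← hp, ← hq] at h1
  rw [h1, splitEntropy, ← add_div, div_self h, negMulLog_one, sub_zero]

@[simp]
theorem splitEntropy_zero_left (q : ℝ) : splitEntropy 0 q = 0 := by simp [splitEntropy]

theorem splitEntropy_nonneg {p q : ℝ} (hp : 0 ≤ p) (hq : 0 ≤ q) : 0 ≤ splitEntropy p q := by
  rcases (add_nonneg hp hq).eq_or_lt with h | h
  · simp [show p = 0 by linarith]
  · rw [splitEntropy_eq h.ne']
    exact mul_nonneg h.le (Real.binEntropy_nonneg (by positivity) ((div_le_one h).2 (by linarith)))

theorem splitEntropy_add_le {p₁ q₁ p₂ q₂ : ℝ} (hp₁ : 0 ≤ p₁) (hq₁ : 0 ≤ q₁) (hp₂ : 0 ≤ p₂)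
    (hq₂ : 0 ≤ q₂) :
    splitEntropy p₁ q₁ + splitEntropy p₂ q₂ ≤ splitEntropy (p₁ + p₂) (q₁ + q₂) := by
  rcases (add_nonneg hp₁ hq₁).eq_or_lt with h₁ | h₁
  · simp [show p₁ = 0 by linarith, show q₁ = 0 by linarith]
  rcases (add_nonneg hp₂ hq₂).eq_or_lt with h₂ | h₂
  · simp [show p₂ = 0 by linarith, show q₂ = 0 by linarith]
  have hs : p₁ + p₂ + (q₁ + q₂) = (p₁ + q₁) + (p₂ + q₂) := by ring
  have hpos : 0 < (p₁ + q₁) + (p₂ + q₂) := by positivity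
  rw [splitEntropy_eq h₁.ne', splitEntropy_eq h₂.ne', splitEntropy_eq (hs ▸ hpos.ne'), hs]
  set m₁ := p₁ + q₁
  set m₂ := p₂ + q₂
  have hx₁ : p₁ / m₁ ∈ Set.Icc (0 : ℝ) 1 :=
    ⟨by positivity, (div_le_one h₁).2 (le_add_of_nonneg_right hq₁)⟩
  have hx₂ : p₂ / m₂ ∈ Set.Icc (0 : ℝ) 1 :=
    ⟨by positivity, (div_le_one h₂).2 (le_add_of_nonneg_right hq₂)⟩
  have hc := Real.strictConcave_binEntropy.concaveOn.2 hx₁ hx₂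
    (div_pos h₁ hpos).le (div_pos h₂ hpos).le (by rw [← add_div, div_self hpos.ne'])
  have e : (m₁ / (m₁ + m₂)) • (p₁ / m₁) + (m₂ / (m₁ + m₂)) • (p₂ / m₂) =
      (p₁ + p₂) / (m₁ + m₂) := by simp only [smul_eq_mul]; field_simp
  rw [e] at hc
  have := mul_le_mul_of_nonneg_left hc hpos.le
  refine le_trans (le_of_eq ?_) this
  simp only [smul_eq_mul]
  field_simp

theorem sum_splitEntropy_le {ι : Type*} (s : Finset ι) {p q : ι → ℝ}
    (hp : ∀ i ∈ s, 0 ≤ p i) (hq : ∀ i ∈ s, 0 ≤ q i) :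
    ∑ i ∈ s, splitEntropy (p i) (q i) ≤ splitEntropy (∑ i ∈ s, p i) (∑ i ∈ s, q i) := by
  classical
  induction s using Finset.induction_on with
  | empty => simp
  | insert a s ha ih =>
    simp only [Finset.sum_insert ha]
    simp only [Finset.mem_insert, forall_eq_or_imp] at hp hq
    exact (add_le_add le_rfl (ih hp.2 hq.2)).trans
      (splitEntropy_add_le hp.1 hq.1 (Finset.sum_nonneg hp.2) (Finset.sum_nonneg hq.2))

theorem sum_splitEntropy_mul_prod_erase_le {ι : Type*} [Fintype ι] [DecidableEq ι] [Nonempty ι]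
    {φ : ℝ} (hφ : φ ∈ Set.Ioo (0 : ℝ) 1) (hφk : φ + φ ^ Fintype.card ι = 1)
    {p q : ι → ℝ} (hp : ∀ i, 0 ≤ p i) (hq : ∀ i, 0 ≤ q i) :
    ∑ j, splitEntropy (p j) (q j) * ∏ i ∈ Finset.univ.erase j, p i ≤
      Fintype.card ι * (φ ^ (Fintype.card ι - 1) *
        splitEntropy (∏ i, p i) (∏ i, (p i + q i) - ∏ i, p i)) := by
  have hle : ∏ i, p i ≤ ∏ i, (p i + q i) :=
    Finset.prod_le_prod (fun i _ => hp i) fun i _ => by linarith [hq i]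
  have hP : 0 ≤ ∏ i, p i := Finset.prod_nonneg fun i _ => hp i
  have hm0 : ∀ i, 0 ≤ p i + q i := fun i => add_nonneg (hp i) (hq i)
  by_cases h0 : ∃ i, p i + q i = 0
  · obtain ⟨i, hi⟩ := h0
    have hpi : p i = 0 := by linarith [hp i, hq i]
    have hz : ∑ j, splitEntropy (p j) (q j) * ∏ i ∈ Finset.univ.erase j, p i = 0 := by
      refine Finset.sum_eq_zero fun j _ => ?_
      by_cases hij : i = j
      · rw [← hij, hpi]; simp
      · rw [Finset.prod_eq_zero (Finset.mem_erase.2 ⟨hij, Finset.mem_univ i⟩) hpi, mul_zero]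
    rw [hz]
    have := splitEntropy_nonneg hP (sub_nonneg.2 hle)
    have := hφ.1
    positivity
  push Not at h0
  have hm : ∀ i, 0 < p i + q i := fun i => (hm0 i).lt_of_ne' (h0 i)
  have hM : 0 < ∏ i, (p i + q i) := Finset.prod_pos fun i _ => hm i
  have h := sum_binEntropy_mul_prod_erase_le hφ hφk (x := fun i => p i / (p i + q i))
    fun i => ⟨div_nonneg (hp i) (hm0 i), (div_le_one (hm i)).2 (by linarith [hq i])⟩
  have h' := mul_le_mul_of_nonneg_left h hM.le
  rw [splitEntropy_eq (by rw [add_sub_cancel]; exact hM.ne'), add_sub_cancel]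
  refine (le_of_eq ?_).trans (h'.trans (le_of_eq ?_))
  · rw [Finset.mul_sum]
    refine Finset.sum_congr rfl fun j _ => ?_
    rw [splitEntropy_eq (hm j).ne', Finset.prod_div_distrib,
      ← Finset.mul_prod_erase _ (fun i => p i + q i) (Finset.mem_univ j)]
    have : ∏ i ∈ Finset.univ.erase j, (p i + q i) ≠ 0 :=
      (Finset.prod_pos fun i _ => hm i).ne'
    field_simp
  · rw [Finset.prod_div_distrib]
    ring

section Marginals

variable {ι : Type*} [Fintype ι] [DecidableEq ι]

/-- The law of `A ∩ s` when `A` has law `μ`. -/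
def marginal (μ : Finset ι → ℝ) (s t : Finset ι) : ℝ := ∑ A with A ∩ s = t, μ A

/-- The law of the union of a `κ`-indexed family of independent sets of law `μ`. -/
def unionLaw (κ : Type*) [Fintype κ] [DecidableEq κ] (μ : Finset ι → ℝ) (B : Finset ι) : ℝ :=
  ∑ A : κ → Finset ι with Finset.univ.biUnion A = B, ∏ j, μ (A j)

/-- The entropy of `A ∩ s` when `A` has law `μ`. -/
noncomputable def marginalEntropy (μ : Finset ι → ℝ) (s : Finset ι) : ℝ :=
  ∑ t ∈ s.powerset, Real.negMulLog (marginal μ s t)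

theorem marginal_nonneg {μ : Finset ι → ℝ} (hμ : ∀ A, 0 ≤ μ A) (s t : Finset ι) :
    0 ≤ marginal μ s t :=
  Finset.sum_nonneg fun A _ => hμ A

theorem marginal_univ (μ : Finset ι → ℝ) (t : Finset ι) : marginal μ Finset.univ t = μ t := by
  simp [marginal, Finset.filter_eq']

theorem marginal_empty (μ : Finset ι → ℝ) : marginal μ ∅ ∅ = ∑ A, μ A := by
  simp [marginal]

theorem marginal_add_marginal_insert (μ : Finset ι → ℝ) {s t : Finset ι} {a : ι} (ha : a ∉ s)
    (ht : t ⊆ s) :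
    marginal μ (insert a s) t + marginal μ (insert a s) (insert a t) = marginal μ s t := by
  have hat : a ∉ t := fun h => ha (ht h)
  rw [marginal, marginal, marginal,
    ← Finset.sum_filter_add_sum_filter_not (Finset.univ.filter fun A => A ∩ s = t) (fun A => a ∉ A),
    Finset.filter_filter, Finset.filter_filter]
  refine congrArg₂ (· + ·) (Finset.sum_congr ?_ fun _ _ => rfl)
    (Finset.sum_congr ?_ fun _ _ => rfl) <;>
  · ext A
    simp only [Finset.mem_filter_univ, Finset.ext_iff, Finset.mem_inter, Finset.mem_insert]
    grind

theorem sum_marginal_insert (μ : Finset ι → ℝ) {s : Finset ι} {a : ι} (ha : a ∉ s) :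
    ∑ t ∈ s.powerset, marginal μ (insert a s) t = ∑ A with a ∉ A, μ A := by
  rw [← Finset.sum_fiberwise_of_maps_to (s := Finset.univ.filter fun A => a ∉ A)
    (g := fun A => A ∩ s) (t := s.powerset)
    fun A _ => Finset.mem_powerset.2 Finset.inter_subset_right]
  refine Finset.sum_congr rfl fun t ht => ?_
  rw [Finset.mem_powerset] at ht
  rw [marginal, Finset.filter_filter]
  congr 1
  ext A
  simp only [Finset.mem_filter_univ]
  have hat : a ∉ t := fun h => ha (ht h)
  grind

variable {κ : Type*} [Fintype κ] [DecidableEq κ]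

theorem marginal_unionLaw (μ : Finset ι → ℝ) (s t : Finset ι) :
    marginal (unionLaw κ μ) s t = unionLaw κ (marginal μ s) t := by
  have h1 : marginal (unionLaw κ μ) s t =
      ∑ A : κ → Finset ι with Finset.univ.biUnion A ∩ s = t, ∏ j, μ (A j) := by
    rw [marginal, ← Finset.sum_fiberwise_of_maps_to (g := fun A => Finset.univ.biUnion A)
      (t := Finset.univ.filter fun B => B ∩ s = t) (by simp)]
    refine Finset.sum_congr rfl fun B hB => ?_
    rw [unionLaw, Finset.filter_filter]
    congr 1
    ext A
    simp only [Finset.mem_filter_univ] at hB ⊢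
    grind
  have hinter : ∀ A : κ → Finset ι,
      Finset.univ.biUnion (fun j => A j ∩ s) = Finset.univ.biUnion A ∩ s := fun A =>
    (Finset.biUnion_inter _ _ _).symm
  rw [h1, unionLaw, ← Finset.sum_fiberwise_of_maps_to (g := fun A j => A j ∩ s)
    (t := Finset.univ.filter fun τ : κ → Finset ι => Finset.univ.biUnion τ = t)
    (by simp [hinter])]
  refine Finset.sum_congr rfl fun τ hτ => ?_
  simp only [marginal]
  rw [Finset.prod_univ_sum, Finset.filter_filter]
  congr 1
  ext A
  simp only [Finset.mem_filter_univ, Fintype.mem_piFinset] at hτ ⊢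
  rw [← hinter A, funext_iff]
  refine ⟨fun h => h.2, fun h => ⟨?_, h⟩⟩
  rw [← hτ]
  exact congrArg Finset.univ.biUnion (funext h)

theorem sum_unionLaw_filter (μ : Finset ι → ℝ) (F : Finset (Finset ι)) :
    ∑ B ∈ F, unionLaw κ μ B =
      ∑ A : κ → Finset ι with Finset.univ.biUnion A ∈ F, ∏ j, μ (A j) := by
  rw [← Finset.sum_fiberwise_of_maps_to (g := fun A => Finset.univ.biUnion A) (t := F) (by simp)]
  refine Finset.sum_congr rfl fun B hB => ?_
  rw [unionLaw, Finset.filter_filter]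
  congr 1
  ext A
  simp only [Finset.mem_filter_univ]
  grind

theorem sum_unionLaw (μ : Finset ι → ℝ) :
    ∑ B, unionLaw κ μ B = (∑ A, μ A) ^ Fintype.card κ := by
  rw [sum_unionLaw_filter, ← Finset.card_univ, ← Finset.prod_const, Finset.prod_univ_sum]
  simp

theorem marginalEntropy_insert (μ : Finset ι → ℝ) {s : Finset ι} {a : ι} (ha : a ∉ s) :
    marginalEntropy μ (insert a s) = marginalEntropy μ s + ∑ t ∈ s.powerset,
      splitEntropy (marginal μ (insert a s) t) (marginal μ (insert a s) (insert a t)) := by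
  rw [marginalEntropy, Finset.sum_powerset_insert ha, marginalEntropy, ← Finset.sum_add_distrib,
    ← Finset.sum_add_distrib]
  refine Finset.sum_congr rfl fun t ht => ?_
  rw [splitEntropy, marginal_add_marginal_insert μ ha (Finset.mem_powerset.1 ht)]
  ring

theorem sum_piFinset_mul_prod_erase {α : Type*} (P : Finset α) (f g : α → ℝ) (j : κ) :
    ∑ τ ∈ Fintype.piFinset fun _ : κ => P, f (τ j) * ∏ i ∈ Finset.univ.erase j, g (τ i) =
      (∑ t ∈ P, f t) * (∑ t ∈ P, g t) ^ (Fintype.card κ - 1) := by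
  have h := Finset.prod_univ_sum (fun _ : κ => P) fun i t => if i = j then f t else g t
  rw [← Finset.mul_prod_erase _ _ (Finset.mem_univ j)] at h
  have he : ∀ c : κ → ℝ, ∀ d : κ → ℝ, ∏ i ∈ Finset.univ.erase j, (if i = j then c i else d i) =
      ∏ i ∈ Finset.univ.erase j, d i := fun c d =>
    Finset.prod_congr rfl fun i hi => if_neg (Finset.ne_of_mem_erase hi)
  have h' : (∑ t ∈ P, f t) * ∏ i ∈ Finset.univ.erase j, ∑ t ∈ P, g t =
      ∑ τ ∈ Fintype.piFinset fun _ : κ => P,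
        f (τ j) * ∏ i ∈ Finset.univ.erase j, g (τ i) := by
    refine Eq.trans ?_ (h.trans ?_)
    · simp only [if_true]
      congr 1
      exact Finset.prod_congr rfl fun i hi => by simp [Finset.ne_of_mem_erase hi]
    · refine Finset.sum_congr rfl fun τ _ => ?_
      rw [← Finset.mul_prod_erase _ _ (Finset.mem_univ j), if_pos rfl, he]
  rw [← h', Finset.prod_const, Finset.card_erase_of_mem (Finset.mem_univ j), Finset.card_univ]

theorem pow_mul_sum_splitEntropy_le [Nonempty κ] {φ : ℝ} (hφ : φ ∈ Set.Ioo (0 : ℝ) 1)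
    (hφk : φ + φ ^ Fintype.card κ = 1) {μ : Finset ι → ℝ} (hμ : ∀ A, 0 ≤ μ A) {s : Finset ι}
    {a : ι} (ha : a ∉ s) :
    (∑ A with a ∉ A, μ A) ^ (Fintype.card κ - 1) * ∑ t ∈ s.powerset,
        splitEntropy (marginal μ (insert a s) t) (marginal μ (insert a s) (insert a t)) ≤
      φ ^ (Fintype.card κ - 1) * ∑ t ∈ s.powerset,
        splitEntropy (marginal (unionLaw κ μ) (insert a s) t)
          (marginal (unionLaw κ μ) (insert a s) (insert a t)) := by
  set p : Finset ι → ℝ := fun t => marginal μ (insert a s) t with hp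
  set q : Finset ι → ℝ := fun t => marginal μ (insert a s) (insert a t) with hq
  have hp0 : ∀ t, 0 ≤ p t := fun t => marginal_nonneg hμ _ _
  have hq0 : ∀ t, 0 ≤ q t := fun t => marginal_nonneg hμ _ _
  set R := Fintype.piFinset fun _ : κ => s.powerset with hR
  have hk0 : (0 : ℝ) < Fintype.card κ := Nat.cast_pos.2 Fintype.card_pos
  have hfil : ∀ t ∈ s.powerset, ∀ ν : Finset ι → ℝ,
      unionLaw κ ν t = ∑ τ ∈ R with Finset.univ.biUnion τ = t, ∏ j, ν (τ j) := by
    intro t ht ν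
    rw [unionLaw]
    congr 1
    ext τ
    simp only [hR, Finset.mem_filter, Finset.mem_univ, true_and, Fintype.mem_piFinset,
      Finset.mem_powerset] at ht ⊢
    refine ⟨fun h => ⟨fun j => ?_, h⟩, fun h => h.2⟩
    exact (Finset.subset_biUnion_of_mem τ (Finset.mem_univ j)).trans (h ▸ ht)
  have hsum : ∑ τ ∈ R, splitEntropy (∏ j, p (τ j)) (∏ j, (p (τ j) + q (τ j)) - ∏ j, p (τ j)) ≤
      ∑ t ∈ s.powerset, splitEntropy (marginal (unionLaw κ μ) (insert a s) t)
          (marginal (unionLaw κ μ) (insert a s) (insert a t)) := by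
    rw [← Finset.sum_fiberwise_of_maps_to (g := fun τ : κ → Finset ι => Finset.univ.biUnion τ)
      (t := s.powerset) (by simp [hR])]
    refine Finset.sum_le_sum fun t ht => ?_
    have hadd := marginal_add_marginal_insert (unionLaw κ μ) ha (Finset.mem_powerset.1 ht)
    have e1 : marginal (unionLaw κ μ) (insert a s) t =
        ∑ τ ∈ R with Finset.univ.biUnion τ = t, ∏ j, p (τ j) := by
      rw [marginal_unionLaw, hfil t ht]
    have e2 : marginal (unionLaw κ μ) (insert a s) (insert a t) =
        ∑ τ ∈ R with Finset.univ.biUnion τ = t, (∏ j, (p (τ j) + q (τ j)) - ∏ j, p (τ j)) := by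
      rw [Finset.sum_sub_distrib, ← e1, eq_sub_iff_add_eq, add_comm, hadd, marginal_unionLaw,
        hfil t ht]
      refine Finset.sum_congr rfl fun τ hτ => Finset.prod_congr rfl fun j _ => ?_
      rw [Finset.mem_filter, hR, Fintype.mem_piFinset] at hτ
      exact (marginal_add_marginal_insert μ ha (Finset.mem_powerset.1 (hτ.1 j))).symm
    rw [e1, e2]
    refine sum_splitEntropy_le _ (fun τ _ => Finset.prod_nonneg fun j _ => hp0 _) fun τ _ => ?_
    exact sub_nonneg.2 (Finset.prod_le_prod (fun j _ => hp0 _)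
      fun j _ => le_add_of_nonneg_right (hq0 _))
  have hpt := Finset.sum_le_sum fun (τ : κ → Finset ι) (_ : τ ∈ R) =>
    sum_splitEntropy_mul_prod_erase_le hφ hφk (fun j => hp0 (τ j)) fun j => hq0 (τ j)
  rw [Finset.sum_comm, ← Finset.mul_sum, ← Finset.mul_sum] at hpt
  simp only [hR, sum_piFinset_mul_prod_erase s.powerset (fun t => splitEntropy (p t) (q t)) p]
    at hpt
  rw [Finset.sum_const, Finset.card_univ, nsmul_eq_mul] at hpt
  have hpt' := le_of_mul_le_mul_left hpt hk0
  rw [← sum_marginal_insert μ ha, mul_comm]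
  exact hpt'.trans (mul_le_mul_of_nonneg_left hsum (pow_nonneg hφ.1.le _))

theorem pow_mul_marginalEntropy_le [Nonempty κ] {φ : ℝ} (hφ : φ ∈ Set.Ioo (0 : ℝ) 1)
    (hφk : φ + φ ^ Fintype.card κ = 1) {μ : Finset ι → ℝ} (hμ : ∀ A, 0 ≤ μ A)
    (hμ1 : ∑ A, μ A = 1) {T : ℝ} (hT0 : 0 ≤ T) (hT : ∀ a, T ≤ ∑ A with a ∉ A, μ A)
    (s : Finset ι) :
    T ^ (Fintype.card κ - 1) * marginalEntropy μ s ≤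
      φ ^ (Fintype.card κ - 1) * marginalEntropy (unionLaw κ μ) s := by
  induction s using Finset.induction_on with
  | empty => simp [marginalEntropy, marginal_empty, sum_unionLaw, hμ1]
  | insert a s ha ih =>
    rw [marginalEntropy_insert _ ha, marginalEntropy_insert _ ha, mul_add, mul_add]
    refine add_le_add ih (le_trans ?_ (pow_mul_sum_splitEntropy_le hφ hφk hμ ha))
    refine mul_le_mul_of_nonneg_right (pow_le_pow_left₀ hT0 (hT a) _)
      (Finset.sum_nonneg fun t _ => splitEntropy_nonneg ?_ ?_) <;>
    exact marginal_nonneg hμ _ _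

end Marginals

open Real in
theorem binEntropy_le_two_mul_log {ε : ℝ} (h0 : 0 ≤ ε) (h1 : ε ≤ 1 / 2) :
    binEntropy ε ≤ 2 * ε * log (1 / ε) := by
  rcases h0.eq_or_lt with rfl | h0
  · simp
  have h := div_mul_log_one_sub_le h0 (show ε ≤ 1 - ε by linarith) (by linarith)
  rw [sub_sub_cancel, div_mul_eq_mul_div, div_le_iff₀ (by linarith)] at h
  rw [binEntropy, one_div, log_inv, log_inv]
  linarith

open Real in
theorem sum_negMulLog_le {ι : Type*} (s : Finset ι) {p : ι → ℝ} (hp : ∀ i ∈ s, 0 ≤ p i) :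
    ∑ i ∈ s, negMulLog (p i) ≤ negMulLog (∑ i ∈ s, p i) + (∑ i ∈ s, p i) * log s.card := by
  rcases s.eq_empty_or_nonempty with rfl | hs
  · simp
  have hc : (0 : ℝ) < s.card := Nat.cast_pos.2 hs.card_pos
  have h := concaveOn_negMulLog.le_map_sum (t := s) (w := fun _ => (s.card : ℝ)⁻¹) (p := p)
    (fun _ _ => inv_nonneg.2 hc.le)
    (by rw [Finset.sum_const, nsmul_eq_mul, mul_inv_cancel₀ hc.ne']) hp
  simp only [smul_eq_mul, ← Finset.mul_sum] at h
  rw [inv_mul_le_iff₀ hc, negMulLog_mul, negMulLog, log_inv] at h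
  refine h.trans (le_of_eq ?_)
  field_simp
  ring

section Uniform

variable {ι : Type*} [DecidableEq ι]

/-- The uniform law on the set system `F`. -/
noncomputable def uniformLaw (F : Finset (Finset ι)) (A : Finset ι) : ℝ :=
  if A ∈ F then (F.card : ℝ)⁻¹ else 0

theorem uniformLaw_nonneg (F : Finset (Finset ι)) (A : Finset ι) : 0 ≤ uniformLaw F A := by
  unfold uniformLaw
  positivity

variable [Fintype ι] {κ : Type*} [Fintype κ] [DecidableEq κ]

theorem unionLaw_nonneg {μ : Finset ι → ℝ} (hμ : ∀ A, 0 ≤ μ A) (B : Finset ι) :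
    0 ≤ unionLaw κ μ B :=
  Finset.sum_nonneg fun _ _ => Finset.prod_nonneg fun _ _ => hμ _

theorem sum_uniformLaw_filter (F : Finset (Finset ι)) (P : Finset ι → Prop) [DecidablePred P] :
    ∑ A with P A, uniformLaw F A = (F.filter P).card / F.card := by
  simp only [uniformLaw]
  rw [← Finset.sum_filter, Finset.sum_const, nsmul_eq_mul, div_eq_mul_inv, Finset.filter_filter]
  congr 3
  ext A
  simp [and_comm]

theorem sum_uniformLaw {F : Finset (Finset ι)} (hF : F.Nonempty) :
    ∑ A, uniformLaw F A = 1 := by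
  have h := sum_uniformLaw_filter F fun _ => True
  simp only [Finset.filter_true] at h
  rw [h, div_self (Nat.cast_ne_zero.2 hF.card_pos.ne')]

theorem marginalEntropy_uniformLaw {F : Finset (Finset ι)} (hF : F.Nonempty) :
    marginalEntropy (uniformLaw F) Finset.univ = Real.log F.card := by
  have hc : (F.card : ℝ) ≠ 0 := Nat.cast_ne_zero.2 hF.card_pos.ne'
  have h : ∀ A, Real.negMulLog (uniformLaw F A) =
      if A ∈ F then (F.card : ℝ)⁻¹ * Real.log F.card else 0 := by
    intro A
    unfold uniformLaw
    split_ifs <;> simp [Real.negMulLog]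
  simp only [marginalEntropy, marginal_univ, h, Finset.powerset_univ]
  rw [← Finset.sum_filter, Finset.sum_const, Finset.filter_univ_mem, nsmul_eq_mul,
    mul_inv_cancel_left₀ hc]

theorem sum_unionLaw_uniformLaw (F : Finset (Finset ι)) :
    ∑ B ∈ F, unionLaw κ (uniformLaw F) B =
      (((Fintype.piFinset fun _ : κ => F).filter
        fun A => Finset.univ.biUnion A ∈ F).card : ℝ) / (F.card : ℝ) ^ Fintype.card κ := by
  rw [sum_unionLaw_filter]
  simp only [uniformLaw, Finset.prod_ite_zero, Finset.mem_univ, true_imp_iff, Finset.prod_const,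
    Finset.card_univ]
  rw [← Finset.sum_filter, Finset.sum_const, nsmul_eq_mul, inv_pow, div_eq_mul_inv,
    Finset.filter_filter]
  congr 3
  ext A
  simp [and_comm]

theorem unionLaw_uniformLaw_eq_zero {F : Finset (Finset ι)} {B : Finset ι}
    (hB : B ∉ (Fintype.piFinset fun _ : κ => F).image fun A => Finset.univ.biUnion A) :
    unionLaw κ (uniformLaw F) B = 0 := by
  refine Finset.sum_eq_zero fun A hA => ?_
  by_contra h
  refine hB (Finset.mem_image.2 ⟨A, Fintype.mem_piFinset.2 fun j => ?_, by simpa using hA⟩)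
  by_contra hj
  exact h (Finset.prod_eq_zero (Finset.mem_univ j) (if_neg hj))

open Real in
theorem marginalEntropy_unionLaw_uniformLaw_le {F : Finset (Finset ι)} (hF : F.Nonempty) {ε : ℝ}
    (hε : ε ≤ 1 / 2) (hclosed : 1 - ε ≤ ∑ B ∈ F, unionLaw κ (uniformLaw F) B) :
    marginalEntropy (unionLaw κ (uniformLaw F)) Finset.univ ≤
      log F.card + Fintype.card κ * ε * log F.card + 2 * ε * log (1 / ε) := by
  set ν := unionLaw κ (uniformLaw F) with hν
  have hν0 : ∀ B, 0 ≤ ν B := unionLaw_nonneg (uniformLaw_nonneg F)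
  set R := ((Fintype.piFinset fun _ : κ => F).image fun A => Finset.univ.biUnion A) \ F with hR
  have hsplit : ∀ f : ℝ → ℝ, f 0 = 0 →
      ∑ B, f (ν B) = ∑ B ∈ F, f (ν B) + ∑ B ∈ R, f (ν B) := by
    intro f hf
    rw [← Finset.sum_union Finset.disjoint_sdiff]
    refine (Finset.sum_subset (Finset.subset_univ _) fun B _ hB => ?_).symm
    rw [Finset.union_sdiff_self_eq_union, Finset.mem_union, not_or] at hB
    rw [hν, unionLaw_uniformLaw_eq_zero hB.2, hf]
  have h1 := hsplit id rfl
  simp only [id, hν, sum_unionLaw, sum_uniformLaw hF, one_pow] at h1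
  rw [← hν] at h1
  set e := ∑ B ∈ R, ν B with he
  have he0 : 0 ≤ e := Finset.sum_nonneg fun B _ => hν0 B
  have hq : ∑ B ∈ F, ν B = 1 - e := by linarith
  rw [hq] at hclosed
  have heε : e ≤ ε := by linarith
  have hL : 0 ≤ log F.card := log_natCast_nonneg _
  have hRlog : log R.card ≤ Fintype.card κ * log F.card := by
    rcases R.eq_empty_or_nonempty with h | h
    · rw [h]; simp; positivity
    rw [← log_pow]
    refine log_le_log (Nat.cast_pos.2 h.card_pos) ?_
    have : R.card ≤ F.card ^ Fintype.card κ :=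
      (Finset.card_le_card Finset.sdiff_subset).trans
        (Finset.card_image_le.trans (by simp))
    exact_mod_cast this
  have hent : marginalEntropy ν Finset.univ =
      ∑ B ∈ F, negMulLog (ν B) + ∑ B ∈ R, negMulLog (ν B) := by
    rw [← hsplit negMulLog negMulLog_zero]
    simp [marginalEntropy, marginal_univ]
  have hA := sum_negMulLog_le F fun B _ => hν0 B
  have hB := sum_negMulLog_le R fun B _ => hν0 B
  rw [hq] at hA
  rw [← he] at hB
  have hbin : negMulLog (1 - e) + negMulLog e ≤ 2 * ε * log (1 / ε) := by
    rw [add_comm, ← binEntropy_eq_negMulLog_add_negMulLog_one_sub]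
    refine le_trans ?_ (binEntropy_le_two_mul_log (he0.trans heε) hε)
    exact binEntropy_strictMonoOn.monotoneOn ⟨he0, by linarith⟩
      ⟨he0.trans heε, by linarith⟩ heε
  have hC : e * log R.card ≤ ε * (Fintype.card κ * log F.card) :=
    mul_le_mul heε hRlog (log_natCast_nonneg _) (he0.trans heε)
  have hD : (1 - e) * log F.card ≤ log F.card := by nlinarith
  rw [hent]
  linarith

end Uniform

/-- Approximate `k`-union closed set systems contain an element belonging
to at least an `α_k/(1+α_k) - δ` fraction of the sets, where
`δ = (k ε + 2 ε log(1/ε) / log |F|)^(1/(k-1))` and `α_k` is the unique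
positive solution of `x (1+x)^(k-1) = 1`. -/
theorem approx_union_closed (k : ℕ) (hk : 2 ≤ k) (ε : ℝ) (hε0 : 0 ≤ ε)
    (hε1 : ε < 1 / 2) (n : ℕ) (F : Finset (Finset (Fin n)))
    (hFne : F.Nonempty) (hF : F ≠ {∅})
    (hclosed : (1 - ε) * (F.card : ℝ) ^ k ≤
      (((Fintype.piFinset fun _ : Fin k => F).filter
        fun A : Fin k → Finset (Fin n) => Finset.univ.biUnion A ∈ F).card : ℝ))
    (α : ℝ) (hα : 0 < α) (hαeq : α * (1 + α) ^ ((k : ℝ) - 1) = 1) :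
    ∃ i : Fin n,
      (α / (1 + α) -
          ((k : ℝ) * ε + 2 * ε * Real.log (1 / ε) / Real.log (F.card : ℝ)) ^
            (1 / ((k : ℝ) - 1))) * (F.card : ℝ) ≤
        ((F.filter fun A => i ∈ A).card : ℝ) := by
  set L := Real.log (F.card : ℝ) with hL
  set D := (k : ℝ) * ε + 2 * ε * Real.log (1 / ε) / L with hD
  set δ := D ^ (1 / ((k : ℝ) - 1)) with hδ
  have hN : (0 : ℝ) < F.card := Nat.cast_pos.2 hFne.card_pos
  have hk1 : ((k - 1 : ℕ) : ℝ) = (k : ℝ) - 1 := by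
    rw [Nat.cast_sub (by omega), Nat.cast_one]
  have hlogε : 0 ≤ Real.log (1 / ε) := by
    rw [one_div, Real.log_inv]
    exact neg_nonneg.2 (Real.log_nonpos hε0 (by linarith))
  have hL0 : 0 ≤ L := Real.log_natCast_nonneg _
  have hD0 : 0 ≤ D := by positivity
  have hδ0 : 0 ≤ δ := Real.rpow_nonneg hD0 _
  obtain ⟨A₀, hA₀, hne⟩ : ∃ A ∈ F, A.Nonempty := by
    by_contra! h
    exact hF (Finset.eq_singleton_iff_nonempty_unique_mem.2 ⟨hFne, h⟩)
  obtain ⟨i₀, hi₀⟩ := hne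
  rcases Nat.lt_or_ge 1 F.card with hcard | hcard
  swap
  · refine ⟨i₀, ?_⟩
    have h1 : F.card = 1 := le_antisymm hcard hFne.card_pos
    have h2 : 1 ≤ (F.filter fun A => i₀ ∈ A).card :=
      Finset.card_pos.2 ⟨A₀, Finset.mem_filter.2 ⟨hA₀, hi₀⟩⟩
    have h3 : α / (1 + α) ≤ 1 := (div_le_one (by positivity)).2 (by linarith)
    have h4 : (1 : ℝ) ≤ (F.filter fun A => i₀ ∈ A).card := by exact_mod_cast h2
    rw [h1, Nat.cast_one, mul_one]
    linarith
  have hLpos : 0 < L := Real.log_pos (by exact_mod_cast hcard)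
  by_contra! hcon
  have : Nonempty (Fin n) := ⟨i₀⟩
  have : Nonempty (Fin k) := ⟨⟨0, by omega⟩⟩
  set φ := 1 / (1 + α) with hφdef
  have hφ : φ ∈ Set.Ioo (0 : ℝ) 1 :=
    ⟨by positivity, (div_lt_one (by positivity)).2 (by linarith)⟩
  rw [← hk1, Real.rpow_natCast] at hαeq
  have hφpow : φ ^ (k - 1) = α := by
    rw [hφdef, one_div, inv_pow]
    exact (eq_inv_of_mul_eq_one_left hαeq).symm
  have hφk : φ + φ ^ Fintype.card (Fin k) = 1 := by
    have e : k = (k - 1) + 1 := by omega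
    rw [Fintype.card_fin, e, pow_succ, hφpow, hφdef]
    field_simp
  have hsum : ∀ a : Fin n, ∑ A with a ∉ A, uniformLaw F A =
      1 - ((F.filter fun A => a ∈ A).card : ℝ) / F.card := by
    intro a
    rw [sum_uniformLaw_filter, eq_sub_iff_add_eq, ← add_div, div_eq_one_iff_eq hN.ne', add_comm]
    exact_mod_cast Finset.card_filter_add_card_filter_not (s := F) fun A => a ∈ A
  obtain ⟨a, ha⟩ := Finite.exists_min fun a : Fin n => ∑ A with a ∉ A, uniformLaw F A
  set T := ∑ A with a ∉ A, uniformLaw F A with hT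
  have hTgt : φ + δ < T := by
    rw [hT, hsum a]
    have h := hcon a
    rw [← div_lt_iff₀ hN] at h
    have e : α / (1 + α) = 1 - φ := by rw [hφdef]; field_simp; ring
    rw [e] at h
    linarith
  have hlow := pow_mul_marginalEntropy_le hφ hφk (uniformLaw_nonneg F) (sum_uniformLaw hFne)
    (by linarith [hφ.1]) ha Finset.univ
  have hup := marginalEntropy_unionLaw_uniformLaw_le (κ := Fin k) hFne hε1.le (by
    rw [sum_unionLaw_uniformLaw, le_div_iff₀ (by positivity), Fintype.card_fin]
    exact hclosed)
  rw [marginalEntropy_uniformLaw hFne, Fintype.card_fin, ← hL] at hlow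
  rw [Fintype.card_fin, ← hL] at hup
  have hup' : L + k * ε * L + 2 * ε * Real.log (1 / ε) = L * (1 + D) := by
    rw [hD]; field_simp; ring
  rw [hup'] at hup
  have hδpow : δ ^ (k - 1) = D := by
    rw [hδ, ← Real.rpow_natCast, ← Real.rpow_mul hD0, hk1, one_div_mul_cancel, Real.rpow_one]
    rw [← hk1]
    exact Nat.cast_ne_zero.2 (by omega)
  have hTpow : φ ^ (k - 1) + D < T ^ (k - 1) := by
    rw [← hδpow]
    exact (pow_add_pow_le hφ.1.le hδ0 (by omega)).trans_lt
      (pow_lt_pow_left₀ hTgt (add_nonneg hφ.1.le hδ0) (by omega))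
  have hφ1 : φ ^ (k - 1) * D ≤ D :=
    mul_le_of_le_one_left hD0 (pow_le_one₀ hφ.1.le hφ.2.le)
  have h1 := mul_le_mul_of_nonneg_left hup (pow_nonneg hφ.1.le (k - 1))
  have h2 : φ ^ (k - 1) * (1 + D) * L < T ^ (k - 1) * L :=
    mul_lt_mul_of_pos_right (by linarith) hLpos
  linarith
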